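/- Suppose G ⊆ Sym ℝ[X̄]^{t×t} and M_G is archimedean. The map sending (x,[v]) ∈ S_G × ℙ^{t−1}(ℝ) (with v a unit vector) to the state p ↦ ⟨p(x)v,v⟩ is a well-defined bijection between S_G × ℙ^{t−1}(ℝ) and the set of pure states on (Sym ℝ[X̄]^{t×t}, M_G). -/

import Mathlib

open Matrix

variable (n t : ℕ)

/-- Membership in the quadratic module `M_G` generated by `G` in `ℝ[X̄]^{t×t}`. -/
def InQM (G : Set (Matrix (Fin t) (Fin t) (MvPolynomial (Fin n) ℝ)))
    (f : Matrix (Fin t) (Fin t) (MvPolynomial (Fin n) ℝ)) : Prop :=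
  ∃ (N : ℕ) (g p : Fin N → Matrix (Fin t) (Fin t) (MvPolynomial (Fin n) ℝ)),
    (∀ i, g i = 1 ∨ g i ∈ G) ∧ f = ∑ i, (p i)ᵀ * g i * p i

/-- The positivity set `S_G ⊆ ℝⁿ`. -/
def SG (G : Set (Matrix (Fin t) (Fin t) (MvPolynomial (Fin n) ℝ))) :
    Set (Fin n → ℝ) :=
  {x | ∀ g ∈ G, (g.map (MvPolynomial.eval x)).PosSemidef}

/-- `M_G` is archimedean. -/
def IsArch (G : Set (Matrix (Fin t) (Fin t) (MvPolynomial (Fin n) ℝ))) : Prop :=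
  ∀ a : Matrix (Fin t) (Fin t) (MvPolynomial (Fin n) ℝ),
    ∃ N : ℕ, InQM n t G ((N : Matrix (Fin t) (Fin t) (MvPolynomial (Fin n) ℝ)) - aᵀ * a)

/-- The real vector space of symmetric matrix polynomials. -/
noncomputable def SymSub : Submodule ℝ (Matrix (Fin t) (Fin t) (MvPolynomial (Fin n) ℝ)) where
  carrier := {p | pᵀ = p}
  add_mem' := by
    intro a b ha hb
    simp only [Set.mem_setOf_eq, Matrix.transpose_add] at *
    rw [ha, hb]
  zero_mem' := by simp
  smul_mem' := by
    intro c a ha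
    simp only [Set.mem_setOf_eq, Matrix.transpose_smul] at *
    rw [ha]

theorem one_mem_SymSub : (1 : Matrix (Fin t) (Fin t) (MvPolynomial (Fin n) ℝ)) ∈ SymSub n t :=
  Matrix.transpose_one

/-- A state on `(Sym ℝ[X̄]^{t×t}, M_G)`. -/
def IsState (G : Set (Matrix (Fin t) (Fin t) (MvPolynomial (Fin n) ℝ)))
    (L : SymSub n t →ₗ[ℝ] ℝ) : Prop :=
  L ⟨1, one_mem_SymSub n t⟩ = 1 ∧
    ∀ (p : Matrix (Fin t) (Fin t) (MvPolynomial (Fin n) ℝ)) (hp : p ∈ SymSub n t),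
      InQM n t G p → 0 ≤ L ⟨p, hp⟩

/-- A pure state: an extreme point of the convex set of states. -/
def IsPure (G : Set (Matrix (Fin t) (Fin t) (MvPolynomial (Fin n) ℝ)))
    (L : SymSub n t →ₗ[ℝ] ℝ) : Prop :=
  IsState n t G L ∧
    ∀ (L₁ L₂ : SymSub n t →ₗ[ℝ] ℝ) (θ : ℝ), IsState n t G L₁ → IsState n t G L₂ →
      0 < θ → θ < 1 → L = θ • L₁ + (1 - θ) • L₂ → L₁ = L ∧ L₂ = L

/-- `L` is the state of point evaluation at `(x, v)`. -/
def Represents (L : SymSub n t →ₗ[ℝ] ℝ) (x : Fin n → ℝ) (v : Fin t → ℝ) : Prop :=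
  ∀ (p : Matrix (Fin t) (Fin t) (MvPolynomial (Fin n) ℝ)) (hp : p ∈ SymSub n t),
    L ⟨p, hp⟩ = dotProduct (Matrix.mulVec (p.map (MvPolynomial.eval x)) v) v

section

variable {n t} {G : Set (Matrix (Fin t) (Fin t) (MvPolynomial (Fin n) ℝ))}

namespace InQM

variable {f : Matrix (Fin t) (Fin t) (MvPolynomial (Fin n) ℝ)}

theorem transpose_mul_mul {g : Matrix (Fin t) (Fin t) (MvPolynomial (Fin n) ℝ)}
    (hg : g = 1 ∨ g ∈ G) (a : Matrix (Fin t) (Fin t) (MvPolynomial (Fin n) ℝ)) :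
    InQM n t G (aᵀ * g * a) :=
  ⟨1, fun _ => g, fun _ => a, fun _ => hg, by simp⟩

theorem transpose_mul_self (a : Matrix (Fin t) (Fin t) (MvPolynomial (Fin n) ℝ)) :
    InQM n t G (aᵀ * a) := by
  simpa using transpose_mul_mul (G := G) (Or.inl rfl) a

theorem sq_smul (hf : InQM n t G f) (h : MvPolynomial (Fin n) ℝ) : InQM n t G (h ^ 2 • f) := by
  obtain ⟨N, g, p, hg, rfl⟩ := hf
  refine ⟨N, g, fun i => h • p i, hg, ?_⟩
  simp [Finset.smul_sum, smul_smul, sq]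

theorem transpose_eq (hG : ∀ g ∈ G, gᵀ = g) (hf : InQM n t G f) : fᵀ = f := by
  obtain ⟨N, g, p, hg, rfl⟩ := hf
  rw [transpose_sum]
  refine Finset.sum_congr rfl fun i _ => ?_
  have hi : (g i)ᵀ = g i := by
    rcases hg i with h | h
    · simp [h]
    · exact hG _ h
  simp [hi, Matrix.mul_assoc]

theorem eval_nonneg {x : Fin n → ℝ} (hx : x ∈ SG n t G) (hf : InQM n t G f) (v : Fin t → ℝ) :
    0 ≤ (f.map (MvPolynomial.eval x)) *ᵥ v ⬝ᵥ v := by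
  obtain ⟨N, g, p, hg, rfl⟩ := hf
  have hpsd : (((∑ i, (p i)ᵀ * g i * p i).map (MvPolynomial.eval x))).PosSemidef := by
    have h : (∑ i, (p i)ᵀ * g i * p i).map (MvPolynomial.eval x) =
        ∑ i, ((p i).map (MvPolynomial.eval x))ᴴ * (g i).map (MvPolynomial.eval x) *
          (p i).map (MvPolynomial.eval x) := by
      change (MvPolynomial.eval x).mapMatrix _ = _
      rw [map_sum]
      refine Finset.sum_congr rfl fun i _ => ?_
      simp only [map_mul, RingHom.mapMatrix_apply, conjTranspose_eq_transpose_of_trivial,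
        transpose_map]
    rw [h]
    refine posSemidef_sum _ fun i _ => PosSemidef.conjTranspose_mul_mul_same ?_ _
    rcases hg i with h | h
    · rw [h, Matrix.map_one _ (map_zero _) (map_one _)]
      exact PosSemidef.one
    · exact hx _ h
  have := hpsd.dotProduct_mulVec_nonneg v
  rwa [star_trivial, dotProduct_comm] at this

end InQM

theorem sq_le_mul_of_forall_quadratic_nonneg {A B D : ℝ}
    (h : ∀ s : ℝ, 0 ≤ A + 2 * s * B + s ^ 2 * D) : B ^ 2 ≤ A * D := by
  have := discrim_le_zero (a := D) (b := 2 * B) (c := A) fun s => by linarith [h s]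
  rw [discrim] at this
  linarith

/-- A nonnegative sequence of moments of geometric growth rate `C` contracts by the factor `C`
already at its first step. -/
theorem le_mul_of_sq_le_mul_two_mul {m : ℕ → ℝ} {C K : ℝ} (hC : 0 < C) (h0 : ∀ j, 0 ≤ m j)
    (hsq : ∀ j, m j ^ 2 ≤ m 0 * m (2 * j)) (hK : ∀ j, m j ≤ K * C ^ j) : m 1 ≤ C * m 0 := by
  by_contra! hlt
  rcases (h0 0).eq_or_lt with hm | hm
  · have := hsq 1
    rw [← hm] at this hlt
    nlinarith
  · have key : ∀ k, m 1 ^ 2 ^ k * m 0 ≤ m 0 ^ 2 ^ k * m (2 ^ k) := by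
      intro k
      induction k with
      | zero => simp [mul_comm]
      | succ k ih =>
        have h1 : (m 1 ^ 2 ^ k * m 0) ^ 2 ≤ (m 0 ^ 2 ^ k * m (2 ^ k)) ^ 2 :=
          pow_le_pow_left₀ (mul_nonneg (pow_nonneg (h0 1) _) hm.le) ih 2
        have h2 := mul_le_mul_of_nonneg_left (hsq (2 ^ k)) (pow_nonneg hm.le (2 ^ (k + 1)))
        refine le_of_mul_le_mul_right ?_ hm
        calc m 1 ^ 2 ^ (k + 1) * m 0 * m 0 = (m 1 ^ 2 ^ k * m 0) ^ 2 := by ring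
          _ ≤ _ := h1
          _ = m 0 ^ 2 ^ (k + 1) * m (2 ^ k) ^ 2 := by ring
          _ ≤ _ := h2
          _ = m 0 ^ 2 ^ (k + 1) * m (2 ^ (k + 1)) * m 0 := by rw [pow_succ' 2 k]; ring
    have hr : 1 < m 1 / (C * m 0) := by rwa [one_lt_div (by positivity)]
    obtain ⟨N, hN⟩ := pow_unbounded_of_one_lt (K / m 0) hr
    have h1 : (m 1 / (C * m 0)) ^ N ≤ (m 1 / (C * m 0)) ^ 2 ^ N :=
      pow_le_pow_right₀ hr.le Nat.lt_two_pow_self.le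
    have h2 : (m 1 / (C * m 0)) ^ 2 ^ N ≤ K / m 0 := by
      rw [div_pow, mul_pow, div_le_div_iff₀ (by positivity) hm]
      calc _ ≤ _ := key N
        _ ≤ m 0 ^ 2 ^ N * (K * C ^ 2 ^ N) := by gcongr; exact hK _
        _ = _ := by ring
    linarith

/-- The projection of a matrix polynomial onto its symmetric part. -/
noncomputable def symmPart :
    Matrix (Fin t) (Fin t) (MvPolynomial (Fin n) ℝ) →ₗ[ℝ] SymSub n t :=
  LinearMap.codRestrict (SymSub n t)
    ((1 / 2 : ℝ) • (LinearMap.id + (transposeLinearEquiv (Fin t) (Fin t) ℝ _).toLinearMap))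
    fun a => by
      change _ᵀ = _
      simp [add_comm]

theorem coe_symmPart (a : Matrix (Fin t) (Fin t) (MvPolynomial (Fin n) ℝ)) :
    (symmPart a : Matrix (Fin t) (Fin t) (MvPolynomial (Fin n) ℝ)) = (1 / 2 : ℝ) • (a + aᵀ) :=
  rfl

theorem symmPart_of_mem {a : Matrix (Fin t) (Fin t) (MvPolynomial (Fin n) ℝ)}
    (ha : a ∈ SymSub n t) : symmPart a = ⟨a, ha⟩ := by
  apply Subtype.ext
  have h : aᵀ = a := ha
  rw [coe_symmPart, h, ← two_smul ℝ a, smul_smul]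
  norm_num

theorem symmPart_transpose (a : Matrix (Fin t) (Fin t) (MvPolynomial (Fin n) ℝ)) :
    symmPart aᵀ = symmPart a := by
  apply Subtype.ext
  simp [coe_symmPart, add_comm]

/-- Linear forms on matrix polynomials nonnegative on the quadratic module. -/
def QMNonneg (G : Set (Matrix (Fin t) (Fin t) (MvPolynomial (Fin n) ℝ)))
    (Φ : Matrix (Fin t) (Fin t) (MvPolynomial (Fin n) ℝ) →ₗ[ℝ] ℝ) : Prop :=
  ∀ f, InQM n t G f → 0 ≤ Φ f

theorem IsState.qmNonneg (hG : ∀ g ∈ G, gᵀ = g) {L : SymSub n t →ₗ[ℝ] ℝ}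
    (hL : IsState n t G L) : QMNonneg G (L ∘ₗ symmPart) := fun f hf => by
  have hs : f ∈ SymSub n t := hf.transpose_eq hG
  simpa [symmPart_of_mem hs] using hL.2 f hs hf

theorem IsState.symmPart_one {L : SymSub n t →ₗ[ℝ] ℝ}
    (hL : IsState n t G L) : L (symmPart 1) = 1 := by
  rw [symmPart_of_mem (one_mem_SymSub n t), hL.1]

/-- The moments `Φ (h² p)` are controlled by `Φ (h²)`, uniformly in `h`. -/
theorem QMNonneg.exists_bound (harch : IsArch n t G)
    {p : Matrix (Fin t) (Fin t) (MvPolynomial (Fin n) ℝ)} (hp : pᵀ = p) :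
    ∃ K : ℝ, 0 ≤ K ∧ ∀ Φ, QMNonneg G Φ → ∀ h : MvPolynomial (Fin n) ℝ,
      |Φ (h ^ 2 • p)| ≤ K * Φ (h ^ 2 • 1) := by
  obtain ⟨N, hN⟩ := harch p
  refine ⟨(N + 1) / 2, by positivity, fun Φ hΦ h => ?_⟩
  have h1 := hΦ _ (hN.sq_smul h)
  have h2 := hΦ _ ((InQM.transpose_mul_self (G := G) (p - 1)).sq_smul h)
  have h3 := hΦ _ ((InQM.transpose_mul_self (G := G) (p + 1)).sq_smul h)
  have e0 : h ^ 2 • (N : Matrix (Fin t) (Fin t) (MvPolynomial (Fin n) ℝ)) =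
      (N : ℝ) • (h ^ 2 • (1 : Matrix (Fin t) (Fin t) (MvPolynomial (Fin n) ℝ))) := by
    rw [Nat.cast_smul_eq_nsmul, ← nsmul_one, smul_comm]
  have e2 : h ^ 2 • ((p - 1)ᵀ * (p - 1)) =
      h ^ 2 • (pᵀ * p) - (2 : ℝ) • (h ^ 2 • p) + h ^ 2 • 1 := by
    rw [transpose_sub, hp, transpose_one, two_smul, ← smul_add, ← smul_sub, ← smul_add]
    congr 1; noncomm_ring
  have e3 : h ^ 2 • ((p + 1)ᵀ * (p + 1)) =
      h ^ 2 • (pᵀ * p) + (2 : ℝ) • (h ^ 2 • p) + h ^ 2 • 1 := by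
    rw [transpose_add, hp, transpose_one, two_smul, ← smul_add, ← smul_add, ← smul_add]
    congr 1; noncomm_ring
  rw [smul_sub, e0, map_sub, LinearMap.map_smul, smul_eq_mul] at h1
  rw [e2, map_add, map_sub, LinearMap.map_smul, smul_eq_mul] at h2
  rw [e3, map_add, map_add, LinearMap.map_smul, smul_eq_mul] at h3
  rw [abs_le]
  constructor <;> linarith

/-- Multiplication by a square of a scalar polynomial is a bounded operation with respect to
a linear form nonnegative on an archimedean quadratic module. -/
theorem QMNonneg.exists_sq_smul_le (hG : ∀ g ∈ G, gᵀ = g) (harch : IsArch n t G)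
    {Φ : Matrix (Fin t) (Fin t) (MvPolynomial (Fin n) ℝ) →ₗ[ℝ] ℝ} (hΦ : QMNonneg G Φ)
    (h : MvPolynomial (Fin n) ℝ) :
    ∃ C : ℝ, 0 < C ∧ ∀ f, InQM n t G f → Φ (h ^ 2 • f) ≤ C * Φ f := by
  obtain ⟨N, hN⟩ := harch (h • 1)
  have hsq : ∀ q : MvPolynomial (Fin n) ℝ, 0 ≤ Φ (q ^ 2 • 1) := fun q => hΦ _ <| by
    simpa using (InQM.transpose_mul_self (G := G) 1).sq_smul q
  have hgrow : ∀ j, Φ ((h ^ j) ^ 2 • 1) ≤ Φ 1 * (N + 1 : ℝ) ^ j := by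
    intro j
    induction j with
    | zero => simp
    | succ j ih =>
      have h1 := hΦ _ (hN.sq_smul (h ^ j))
      have e : (h ^ j) ^ 2 • ((N : Matrix (Fin t) (Fin t) (MvPolynomial (Fin n) ℝ)) -
          (h • 1)ᵀ * (h • 1)) = (N : ℝ) • ((h ^ j) ^ 2 • 1) - (h ^ (j + 1)) ^ 2 • 1 := by
        rw [Nat.cast_smul_eq_nsmul, ← nsmul_one, smul_sub, smul_comm]
        simp only [transpose_smul, transpose_one, smul_mul_smul_comm, mul_one, smul_smul]
        congr 2; ring
      rw [e, map_sub, LinearMap.map_smul, smul_eq_mul] at h1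
      have h2 := mul_le_mul_of_nonneg_right ih (by positivity : (0 : ℝ) ≤ N + 1)
      rw [pow_succ (N + 1 : ℝ), ← mul_assoc]
      linarith [hsq (h ^ j)]
  refine ⟨N + 1, by positivity, fun f hf => ?_⟩
  obtain ⟨K, hK0, hK⟩ := QMNonneg.exists_bound harch (hf.transpose_eq hG)
  have := le_mul_of_sq_le_mul_two_mul (m := fun j => Φ ((h ^ j) ^ 2 • f)) (C := N + 1)
    (K := K * Φ 1) (by positivity) (fun j => hΦ _ (hf.sq_smul _)) (fun j => ?_) (fun j => ?_)
  · simpa using this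
  · rw [mul_comm]
    refine sq_le_mul_of_forall_quadratic_nonneg fun s => ?_
    have h1 := hΦ _ (hf.sq_smul (h ^ (2 * j) + MvPolynomial.C s))
    have e : (h ^ (2 * j) + MvPolynomial.C s) ^ 2 • f = (h ^ (2 * j)) ^ 2 • f +
        (2 * s) • ((h ^ j) ^ 2 • f) + s ^ 2 • ((h ^ 0) ^ 2 • f) := by
      simp only [← algebraMap_smul (MvPolynomial (Fin n) ℝ) (2 * s),
        ← algebraMap_smul (MvPolynomial (Fin n) ℝ) (s ^ 2), smul_smul, ← add_smul,
        MvPolynomial.algebraMap_eq, map_mul, map_pow]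
      congr 1
      have : (MvPolynomial.C 2 : MvPolynomial (Fin n) ℝ) = 2 := map_ofNat _ 2
      rw [this]
      ring
    rw [e, map_add, map_add, LinearMap.map_smul, LinearMap.map_smul, smul_eq_mul, smul_eq_mul] at h1
    exact h1
  · calc Φ ((h ^ j) ^ 2 • f) ≤ K * Φ ((h ^ j) ^ 2 • 1) := (le_abs_self _).trans (hK Φ hΦ _)
      _ ≤ K * (Φ 1 * (N + 1) ^ j) := mul_le_mul_of_nonneg_left (hgrow j) hK0
      _ = _ := by ring

/-- A pure state spans an extreme ray: nonnegative linear forms it dominates are multiples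
of it. -/
theorem IsPure.eq_mul_of_le (harch : IsArch n t G)
    {L : SymSub n t →ₗ[ℝ] ℝ} (hL : IsPure n t G L)
    {Φ : Matrix (Fin t) (Fin t) (MvPolynomial (Fin n) ℝ) →ₗ[ℝ] ℝ} (hΦ : QMNonneg G Φ) {C : ℝ}
    (hC : 0 < C) (hle : ∀ f, InQM n t G f → Φ f ≤ C * L (symmPart f)) (p : SymSub n t) :
    Φ p = Φ 1 * L p := by
  have h1 : InQM n t G 1 := by simpa using InQM.transpose_mul_self (G := G) 1
  rcases (hΦ 1 h1).eq_or_lt with h0 | h0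
  · obtain ⟨K, -, hK⟩ := QMNonneg.exists_bound harch (p := p.1) p.2
    have := hK Φ hΦ 1
    simp only [one_pow, one_smul, ← h0, mul_zero, abs_nonpos_iff] at this
    rw [this, ← h0, zero_mul]
  · have hlt : Φ 1 < C + 1 := by
      have := hle 1 h1
      rw [hL.1.symmPart_one] at this
      linarith
    set θ := Φ 1 / (C + 1) with hθ
    have hθ0 : 0 < θ := by positivity
    have hθ1 : θ < 1 := by rwa [hθ, div_lt_one (by positivity)]
    have hθ2 : 0 < 1 - θ := by linarith
    set Ψ : SymSub n t →ₗ[ℝ] ℝ := Φ ∘ₗ (SymSub n t).subtype with hΨ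
    have hmain := hL.2 ((Φ 1)⁻¹ • Ψ) ((1 - θ)⁻¹ • (L - (C + 1)⁻¹ • Ψ)) θ
      ⟨?_, ?_⟩ ⟨?_, ?_⟩ hθ0 hθ1 ?_
    · have := LinearMap.congr_fun hmain.1 p
      simp only [LinearMap.smul_apply, hΨ, LinearMap.comp_apply, Submodule.subtype_apply,
        smul_eq_mul] at this
      rw [← this]
      field_simp
    · simp [hΨ, h0.ne']
    · intro f hs hf
      simpa [hΨ] using mul_nonneg (inv_nonneg.2 h0.le) (hΦ f hf)
    · simp only [hΨ, LinearMap.smul_apply, LinearMap.sub_apply, LinearMap.comp_apply,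
        Submodule.subtype_apply, hL.1.1, smul_eq_mul]
      rw [inv_mul_eq_one₀ hθ2.ne', hθ]
      ring
    · intro f hs hf
      have h2 := hle f hf
      have h3 := hL.1.2 f hs hf
      rw [symmPart_of_mem hs] at h2
      simp only [hΨ, LinearMap.smul_apply, LinearMap.sub_apply, LinearMap.comp_apply,
        Submodule.subtype_apply, smul_eq_mul]
      refine mul_nonneg (inv_nonneg.2 hθ2.le) (sub_nonneg.2 ?_)
      rw [inv_mul_le_iff₀ (by positivity)]
      linarith
    · rw [smul_smul, smul_smul, mul_inv_cancel₀ hθ2.ne', one_smul, hθ]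
      have : Φ 1 / (C + 1) * (Φ 1)⁻¹ = (C + 1)⁻¹ := by field_simp
      rw [this]
      abel

theorem symmPart_smul (f : MvPolynomial (Fin n) ℝ)
    (a : Matrix (Fin t) (Fin t) (MvPolynomial (Fin n) ℝ)) :
    symmPart (f • a) = symmPart (f • (symmPart a).1) := by
  apply Subtype.ext
  simp only [coe_symmPart, transpose_smul, transpose_add, transpose_transpose]
  rw [add_comm aᵀ a, smul_comm f (1 / 2 : ℝ), ← add_smul, ← smul_add]
  norm_num

theorem IsPure.apply_sq_smul (hG : ∀ g ∈ G, gᵀ = g) (harch : IsArch n t G)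
    {L : SymSub n t →ₗ[ℝ] ℝ} (hL : IsPure n t G L) (h : MvPolynomial (Fin n) ℝ)
    (a : Matrix (Fin t) (Fin t) (MvPolynomial (Fin n) ℝ)) :
    L (symmPart (h ^ 2 • a)) = L (symmPart (h ^ 2 • 1)) * L (symmPart a) := by
  have hΦ := hL.1.qmNonneg hG
  obtain ⟨C, hC, hle⟩ := hΦ.exists_sq_smul_le hG harch h
  rw [symmPart_smul]
  obtain ⟨Φ, hΦ'⟩ : ∃ Φ : Matrix (Fin t) (Fin t) (MvPolynomial (Fin n) ℝ) →ₗ[ℝ] ℝ,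
      ∀ b, Φ b = L (symmPart (h ^ 2 • b)) :=
    ⟨(L ∘ₗ symmPart) ∘ₗ DistribSMul.toLinearMap ℝ _ (h ^ 2), fun _ => rfl⟩
  have key := hL.eq_mul_of_le harch (Φ := Φ)
    (fun f hf => by rw [hΦ']; exact hΦ _ (hf.sq_smul h)) hC
    (fun f hf => by rw [hΦ']; exact hle f hf) (symmPart a)
  rwa [hΦ', hΦ'] at key

theorem eq_sub_sq_smul (f : MvPolynomial (Fin n) ℝ)
    (a : Matrix (Fin t) (Fin t) (MvPolynomial (Fin n) ℝ)) :
    f • a = (1 / 4 : ℝ) • ((f + 1) ^ 2 • a - (f - 1) ^ 2 • a) := by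
  have hf : f = (1 / 4 : ℝ) • ((f + 1) ^ 2 - (f - 1) ^ 2) := by
    rw [show (f + 1) ^ 2 - (f - 1) ^ 2 = MvPolynomial.C 4 * f by rw [map_ofNat]; ring,
      ← MvPolynomial.smul_eq_C_mul, smul_smul]
    norm_num
  conv_lhs => rw [hf]
  rw [smul_assoc, sub_smul]

/-- A pure state is multiplicative with respect to scalar polynomials. -/
theorem IsPure.apply_smul (hG : ∀ g ∈ G, gᵀ = g) (harch : IsArch n t G)
    {L : SymSub n t →ₗ[ℝ] ℝ} (hL : IsPure n t G L) (f : MvPolynomial (Fin n) ℝ)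
    (a : Matrix (Fin t) (Fin t) (MvPolynomial (Fin n) ℝ)) :
    L (symmPart (f • a)) = L (symmPart (f • 1)) * L (symmPart a) := by
  rw [eq_sub_sq_smul f a, eq_sub_sq_smul f 1]
  simp only [LinearMap.map_smul, map_sub, hL.apply_sq_smul hG harch _ a, smul_eq_mul]
  ring

theorem IsPure.exists_eval (hG : ∀ g ∈ G, gᵀ = g) (harch : IsArch n t G)
    {L : SymSub n t →ₗ[ℝ] ℝ} (hL : IsPure n t G L) :
    ∃ x : Fin n → ℝ, ∀ f : MvPolynomial (Fin n) ℝ,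
      L (symmPart (f • 1)) = MvPolynomial.eval x f := by
  let φ : MvPolynomial (Fin n) ℝ →ₐ[ℝ] ℝ := AlgHom.ofLinearMap
    ((L ∘ₗ symmPart) ∘ₗ (LinearMap.toSpanSingleton (MvPolynomial (Fin n) ℝ)
      (Matrix (Fin t) (Fin t) (MvPolynomial (Fin n) ℝ)) 1).restrictScalars ℝ)
    (by simpa using hL.1.symmPart_one)
    (fun f g => by simpa [mul_smul] using hL.apply_smul hG harch f (g • 1))
  refine ⟨fun i => φ (MvPolynomial.X i), fun f => ?_⟩
  rw [← MvPolynomial.coe_aeval_eq_eval]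
  exact DFunLike.congr_fun (MvPolynomial.aeval_unique φ) f

theorem IsPure.eq_sum (hG : ∀ g ∈ G, gᵀ = g) (harch : IsArch n t G)
    {L : SymSub n t →ₗ[ℝ] ℝ} (hL : IsPure n t G L) {x : Fin n → ℝ}
    (hx : ∀ f : MvPolynomial (Fin n) ℝ, L (symmPart (f • 1)) = MvPolynomial.eval x f)
    (a : Matrix (Fin t) (Fin t) (MvPolynomial (Fin n) ℝ)) :
    L (symmPart a) = ∑ i, ∑ j, MvPolynomial.eval x (a i j) * L (symmPart (single i j 1)) := by
  conv_lhs => rw [matrix_eq_sum_single a]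
  simp only [map_sum]
  refine Finset.sum_congr rfl fun i _ => Finset.sum_congr rfl fun j _ => ?_
  rw [← hx, ← hL.apply_smul hG harch, smul_single, smul_eq_mul, mul_one]

/-- The linear form `p ↦ ⟨p(x)v, v⟩` on all matrix polynomials. -/
noncomputable def evalForm (x : Fin n → ℝ) (v : Fin t → ℝ) :
    Matrix (Fin t) (Fin t) (MvPolynomial (Fin n) ℝ) →ₗ[ℝ] ℝ where
  toFun p := (p.map (MvPolynomial.eval x)) *ᵥ v ⬝ᵥ v
  map_add' p q := by
    rw [Matrix.map_add _ (map_add _), add_mulVec, add_dotProduct]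
  map_smul' c p := by
    rw [Matrix.map_smul _ _ fun a => by simp, smul_mulVec, smul_dotProduct]
    rfl

theorem evalForm_apply (x : Fin n → ℝ) (v : Fin t → ℝ)
    (p : Matrix (Fin t) (Fin t) (MvPolynomial (Fin n) ℝ)) :
    evalForm x v p = (p.map (MvPolynomial.eval x)) *ᵥ v ⬝ᵥ v := rfl

theorem evalForm_one (x : Fin n → ℝ) (v : Fin t → ℝ) : evalForm x v 1 = v ⬝ᵥ v := by
  rw [evalForm_apply, Matrix.map_one _ (map_zero _) (map_one _), one_mulVec]

theorem isState_evalForm {x : Fin n → ℝ} (hx : x ∈ SG n t G) {v : Fin t → ℝ}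
    (hv : v ⬝ᵥ v = 1) : IsState n t G (evalForm x v ∘ₗ (SymSub n t).subtype) :=
  ⟨by simpa [evalForm_one] using hv, fun _ _ hf => hf.eval_nonneg hx v⟩

/-- Cauchy–Schwarz for a state and the unit matrix. -/
theorem IsState.sq_symmPart_le (hG : ∀ g ∈ G, gᵀ = g) {L : SymSub n t →ₗ[ℝ] ℝ}
    (hL : IsState n t G L) (a : Matrix (Fin t) (Fin t) (MvPolynomial (Fin n) ℝ)) :
    L (symmPart a) ^ 2 ≤ L (symmPart (aᵀ * a)) := by
  rw [← mul_one (L (symmPart (aᵀ * a)))]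
  refine sq_le_mul_of_forall_quadratic_nonneg fun s => ?_
  have h1 := hL.qmNonneg hG _ (InQM.transpose_mul_self (G := G) (a + s • 1))
  have e : (a + s • 1)ᵀ * (a + s • 1) = aᵀ * a + s • a + s • aᵀ + s ^ 2 • 1 := by
    simp only [transpose_add, transpose_smul, transpose_one, add_mul, mul_add, smul_mul_assoc,
      mul_smul_comm, one_mul, mul_one, smul_add, smul_smul, sq]
    abel
  simp only [e, LinearMap.comp_apply, map_add, map_smul, symmPart_transpose, hL.symmPart_one,
    smul_eq_mul] at h1
  linarith

theorem isPure_evalForm (hG : ∀ g ∈ G, gᵀ = g) {x : Fin n → ℝ} (hx : x ∈ SG n t G)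
    {v : Fin t → ℝ} (hv : v ⬝ᵥ v = 1) :
    IsPure n t G (evalForm x v ∘ₗ (SymSub n t).subtype) := by
  set L := evalForm x v ∘ₗ (SymSub n t).subtype
  have main : ∀ (L₁ L₂ : SymSub n t →ₗ[ℝ] ℝ) (θ : ℝ), IsState n t G L₁ → IsState n t G L₂ →
      0 < θ → θ < 1 → L = θ • L₁ + (1 - θ) • L₂ → L₁ = L := by
    intro L₁ L₂ θ h₁ h₂ hθ0 hθ1 heq
    ext ⟨p, hp⟩
    set w := (p.map (MvPolynomial.eval x)) *ᵥ v with hw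
    set K : Matrix (Fin t) (Fin t) ℝ :=
      vecMulVec v w - vecMulVec w v - (w ⬝ᵥ v) • (1 : Matrix (Fin t) (Fin t) ℝ) with hK
    -- `a` has symmetric part `p - ⟨p(x)v, v⟩` and satisfies `a(x)v = 0`
    set a := p + K.map MvPolynomial.C with ha
    have hKx : (K.map MvPolynomial.C).map (MvPolynomial.eval x) = K := by
      ext i j; simp
    have hav : a.map (MvPolynomial.eval x) *ᵥ v = 0 := by
      rw [ha, Matrix.map_add _ (map_add _), hKx, add_mulVec, ← hw, hK]
      simp only [sub_mulVec, vecMulVec_mulVec, smul_mulVec, one_mulVec, hv]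
      ext i
      simp
    have hs : aᵀ * a ∈ SymSub n t := by
      change _ᵀ = _
      simp
    have h0 : L ⟨aᵀ * a, hs⟩ = 0 := by
      change (aᵀ * a).map (MvPolynomial.eval x) *ᵥ v ⬝ᵥ v = 0
      rw [Matrix.map_mul, ← mulVec_mulVec, hav]
      simp
    have hq := InQM.transpose_mul_self (G := G) a
    have h1 := h₁.2 _ hs hq
    have h2 := h₂.2 _ hs hq
    rw [heq] at h0
    simp only [LinearMap.add_apply, LinearMap.smul_apply, smul_eq_mul] at h0
    have h3 : L₁ ⟨aᵀ * a, hs⟩ = 0 := by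
      have := mul_nonneg (sub_pos.2 hθ1).le h2
      have := mul_nonneg hθ0.le h1
      have : θ * L₁ ⟨aᵀ * a, hs⟩ = 0 := by linarith
      exact (mul_eq_zero.1 this).resolve_left hθ0.ne'
    have h4 : L₁ (symmPart a) = 0 := by
      have := h₁.sq_symmPart_le hG a
      rw [symmPart_of_mem hs, h3] at this
      exact pow_eq_zero_iff two_ne_zero |>.1 (le_antisymm this (sq_nonneg _))
    have h5 : symmPart a = ⟨p, hp⟩ - (w ⬝ᵥ v) • symmPart 1 := by
      rw [← symmPart_of_mem hp, ← map_smul, ← map_sub]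
      apply Subtype.ext
      simp only [coe_symmPart]
      congr 1
      ext i j : 1
      rcases eq_or_ne i j with rfl | hij
      · simp [ha, hK, vecMulVec_apply, MvPolynomial.smul_eq_C_mul]
        ring
      · simp [ha, hK, vecMulVec_apply, one_apply_ne hij, one_apply_ne hij.symm]
        ring
    rw [h5, map_sub, map_smul, h₁.symmPart_one, smul_eq_mul, mul_one, sub_eq_zero] at h4
    exact h4
  refine ⟨isState_evalForm hx hv, fun L₁ L₂ θ h₁ h₂ hθ0 hθ1 heq => ⟨main L₁ L₂ θ h₁ h₂ hθ0 hθ1 heq,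
    main L₂ L₁ (1 - θ) h₂ h₁ (by linarith) (by linarith) ?_⟩⟩
  rw [heq, sub_sub_cancel, add_comm]

open scoped MatrixOrder in
theorem Matrix.PosSemidef.exists_eq_conjTranspose_mul_self {ι : Type*} [Fintype ι]
    [DecidableEq ι] {A : Matrix ι ι ℝ} (hA : A.PosSemidef) : ∃ B : Matrix ι ι ℝ, A = Bᴴ * B :=
  CStarAlgebra.nonneg_iff_eq_star_mul_self.1 hA.nonneg

theorem IsPure.exists_represents (hG : ∀ g ∈ G, gᵀ = g) (harch : IsArch n t G)
    {L : SymSub n t →ₗ[ℝ] ℝ} (hL : IsPure n t G L) :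
    ∃ x ∈ SG n t G, ∃ v : Fin t → ℝ, v ⬝ᵥ v = 1 ∧ Represents n t L x v := by
  obtain ⟨x, hx⟩ := hL.exists_eval hG harch
  have hsum := hL.eq_sum hG harch hx
  have hpos := hL.1.qmNonneg hG
  set ρ : Matrix (Fin t) (Fin t) ℝ := of fun i j => L (symmPart (single i j 1)) with hρ
  replace hsum : ∀ a, L (symmPart a) = ∑ i, ∑ j, MvPolynomial.eval x (a i j) * ρ i j := hsum
  have htr : ∑ i, ρ i i = 1 := by
    rw [← hL.1.symmPart_one, hsum]
    refine Finset.sum_congr rfl fun i _ => ?_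
    rw [Finset.sum_eq_single i (fun j _ hj => by simp [one_apply_ne' hj]) (by simp)]
    simp
  obtain ⟨i₀, -, hi₀⟩ : ∃ i ∈ Finset.univ, ρ i i ≠ 0 := by
    by_contra! h
    rw [Finset.sum_eq_zero h] at htr
    exact zero_ne_one htr
  -- the value of `L` on `bᵀ * g * b` for the constant rank one matrix `b = u wᵀ`
  have hrank : ∀ (g : Matrix (Fin t) (Fin t) (MvPolynomial (Fin n) ℝ)) (u w : Fin t → ℝ),
      g = 1 ∨ g ∈ G →
      0 ≤ (g.map (MvPolynomial.eval x) *ᵥ u ⬝ᵥ u) * ∑ i, ∑ j, w i * w j * ρ i j := by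
    intro g u w hg
    have h1 := hpos _ (InQM.transpose_mul_mul hg ((vecMulVec u w).map MvPolynomial.C))
    rw [LinearMap.comp_apply, hsum] at h1
    convert h1 using 1
    rw [Finset.mul_sum]
    refine Finset.sum_congr rfl fun i _ => ?_
    rw [Finset.mul_sum]
    refine Finset.sum_congr rfl fun j _ => ?_
    rw [← mul_assoc]
    congr 1
    simp only [mul_apply, transpose_apply, map_apply, vecMulVec_apply, map_sum, map_mul,
      MvPolynomial.eval_C, dotProduct, mulVec, Finset.sum_mul]
    rw [Finset.sum_comm]
    refine Finset.sum_congr rfl fun k _ => Finset.sum_congr rfl fun l _ => ?_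
    ring
  have hρpsd : ρ.PosSemidef := by
    refine PosSemidef.of_dotProduct_mulVec_nonneg ?_ fun w => ?_
    · ext i j
      simp only [hρ, conjTranspose_apply, of_apply, star_trivial]
      rw [← symmPart_transpose, transpose_single]
    · have := hrank 1 (Pi.single i₀ 1) w (Or.inl rfl)
      rw [Matrix.map_one _ (map_zero _) (map_one _), one_mulVec, single_one_dotProduct,
        Pi.single_eq_same, one_mul] at this
      refine this.trans_eq ?_
      simp only [star_trivial, dotProduct, mulVec, Finset.mul_sum]
      refine Finset.sum_congr rfl fun i _ => Finset.sum_congr rfl fun j _ => ?_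
      ring
  have hxS : x ∈ SG n t G := by
    intro g hg
    refine PosSemidef.of_dotProduct_mulVec_nonneg ?_ fun u => ?_
    · rw [IsHermitian, conjTranspose_eq_transpose_of_trivial, ← transpose_map, hG g hg]
    · have h1 := hrank g u (Pi.single i₀ 1) (Or.inr hg)
      have h2 : ∑ i, ∑ j, (Pi.single i₀ 1 : Fin t → ℝ) i * (Pi.single i₀ 1 : Fin t → ℝ) j * ρ i j =
          ρ i₀ i₀ := by
        simp [Pi.single_apply]
      rw [h2] at h1
      have h3 : 0 < ρ i₀ i₀ := lt_of_le_of_ne hρpsd.diag_nonneg hi₀.symm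
      rw [star_trivial, dotProduct_comm]
      exact nonneg_of_mul_nonneg_left h1 h3
  obtain ⟨B, hB⟩ := hρpsd.exists_eq_conjTranspose_mul_self
  have hdecomp : ∀ a, L (symmPart a) = ∑ k, evalForm x (B k) a := by
    intro a
    rw [hsum, hB]
    simp only [evalForm_apply, dotProduct, mulVec, mul_apply, conjTranspose_apply, star_trivial,
      map_apply, Finset.mul_sum, Finset.sum_mul]
    symm
    rw [Finset.sum_comm]
    refine Finset.sum_congr rfl fun i _ => ?_
    rw [Finset.sum_comm]
    refine Finset.sum_congr rfl fun j _ => Finset.sum_congr rfl fun k _ => ?_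
    ring
  obtain ⟨k, -, hk⟩ : ∃ k ∈ Finset.univ, B k ⬝ᵥ B k ≠ 0 := by
    by_contra! h
    have h1 := hdecomp 1
    simp only [evalForm_one] at h1
    rw [hL.1.symmPart_one, Finset.sum_eq_zero h] at h1
    exact one_ne_zero h1
  have hkpos : 0 < B k ⬝ᵥ B k :=
    lt_of_le_of_ne (Finset.sum_nonneg fun i _ => mul_self_nonneg _) hk.symm
  have hmul := hL.eq_mul_of_le harch (Φ := evalForm x (B k))
    (fun f hf => hf.eval_nonneg hxS _) one_pos fun f hf => by
      rw [one_mul, hdecomp]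
      exact Finset.single_le_sum (f := fun k => evalForm x (B k) f)
        (fun k _ => hf.eval_nonneg hxS _) (Finset.mem_univ k)
  have hsqrt := Real.mul_self_sqrt hkpos.le
  refine ⟨x, hxS, (√(B k ⬝ᵥ B k))⁻¹ • B k, ?_, fun p hp => ?_⟩
  · rw [smul_dotProduct, dotProduct_smul, smul_smul, ← mul_inv, hsqrt, smul_eq_mul,
      inv_mul_cancel₀ hk]
  · have := hmul ⟨p, hp⟩
    rw [evalForm_one, evalForm_apply] at this
    rw [mulVec_smul, smul_dotProduct, dotProduct_smul, smul_smul, ← mul_inv, hsqrt, this,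
      smul_eq_mul, inv_mul_cancel_left₀ hk]

theorem Represents.of_mk_eq {L : SymSub n t →ₗ[ℝ] ℝ} {x : Fin n → ℝ} {v w : Fin t → ℝ}
    (hL : Represents n t L x v) (hv0 : v ≠ 0) (hw0 : w ≠ 0) (hv : v ⬝ᵥ v = 1) (hw : w ⬝ᵥ w = 1)
    (h : Projectivization.mk ℝ v hv0 = Projectivization.mk ℝ w hw0) : Represents n t L x w := by
  obtain ⟨c, rfl⟩ := (Projectivization.mk_eq_mk_iff' ℝ v w hv0 hw0).1 h
  have hc : c * c = 1 := by
    simpa [hw] using hv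
  intro p hp
  rw [hL p hp, mulVec_smul, smul_dotProduct, dotProduct_smul, smul_smul, hc, one_smul]

theorem Represents.unique {L : SymSub n t →ₗ[ℝ] ℝ} {x x' : Fin n → ℝ} {v v' : Fin t → ℝ}
    (hL : Represents n t L x v) (hL' : Represents n t L x' v') (hv0 : v ≠ 0) (hv0' : v' ≠ 0)
    (hv : v ⬝ᵥ v = 1) (hv' : v' ⬝ᵥ v' = 1) :
    x = x' ∧ Projectivization.mk ℝ v hv0 = Projectivization.mk ℝ v' hv0' := by
  constructor
  · ext i
    have hs : (MvPolynomial.X i : MvPolynomial (Fin n) ℝ) •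
        (1 : Matrix (Fin t) (Fin t) (MvPolynomial (Fin n) ℝ)) ∈ SymSub n t := by
      change _ᵀ = _
      simp
    have key : ∀ (y : Fin n → ℝ) (u : Fin t → ℝ), u ⬝ᵥ u = 1 →
        ((MvPolynomial.X i : MvPolynomial (Fin n) ℝ) •
          (1 : Matrix (Fin t) (Fin t) (MvPolynomial (Fin n) ℝ))).map (MvPolynomial.eval y) *ᵥ u
          ⬝ᵥ u = y i := fun y u hu => by
      have : ((MvPolynomial.X i : MvPolynomial (Fin n) ℝ) •
          (1 : Matrix (Fin t) (Fin t) (MvPolynomial (Fin n) ℝ))).map (MvPolynomial.eval y) =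
          y i • 1 := by
        ext k l
        rcases eq_or_ne k l with rfl | hkl
        · simp
        · simp [one_apply_ne hkl]
      rw [this, smul_mulVec, one_mulVec, smul_dotProduct, hu, smul_eq_mul, mul_one]
    rw [← key x v hv, ← hL _ hs, hL' _ hs, key x' v' hv']
  · have hprod : ∀ i j, v i * v j = v' i * v' j := fun i j => by
      have h1 := hL _ (symmPart (single i j 1)).2
      rw [hL' _ (symmPart (single i j 1)).2] at h1
      have key : ∀ (y : Fin n → ℝ) (u : Fin t → ℝ),
          (symmPart (n := n) (single i j 1)).1.map (MvPolynomial.eval y) *ᵥ u ⬝ᵥ u =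
            u i * u j := fun y u => by
        have : (symmPart (n := n) (single i j 1)).1.map (MvPolynomial.eval y) =
            (1 / 2 : ℝ) • (single i j 1 + single j i 1) := by
          rw [coe_symmPart, transpose_single]
          ext k l
          simp only [map_apply, Matrix.smul_apply, Matrix.add_apply, single_apply,
            MvPolynomial.smul_eval, map_add, apply_ite (MvPolynomial.eval y), map_one, map_zero,
            smul_eq_mul]
        rw [this, smul_mulVec, add_mulVec, smul_dotProduct, add_dotProduct]
        simp [single_mulVec, dotProduct, Function.update_apply]
        ring
      rw [key, key] at h1
      exact h1.symm
    rw [Projectivization.mk_eq_mk_iff']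
    refine ⟨v' ⬝ᵥ v, ?_⟩
    ext i
    simp only [Pi.smul_apply, smul_eq_mul, dotProduct, Finset.sum_mul]
    calc ∑ j, v' j * v j * v' i = ∑ j, (v' i * v' j) * v j :=
          Finset.sum_congr rfl fun j _ => by ring
      _ = ∑ j, v i * (v j * v j) := Finset.sum_congr rfl fun j _ => by rw [← hprod]; ring
      _ = v i := by rw [← Finset.mul_sum]; exact (congrArg _ hv).trans (mul_one _)

end

/-- **Corollary 10.** If `M_G` is archimedean, the assignment
`(x,[v]) ↦ (p ↦ ⟨p(x)v,v⟩)` is a well-defined bijection between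
`S_G × ℙ^{t−1}(ℝ)` and the set of pure states on `(Sym ℝ[X̄]^{t×t}, M_G)`:
it is well defined on projective classes, lands in pure states, is surjective onto the
pure states, and is injective. -/
theorem stmt12 (G : Set (Matrix (Fin t) (Fin t) (MvPolynomial (Fin n) ℝ)))
    (hG : ∀ g ∈ G, gᵀ = g) (harch : IsArch n t G) :
    -- well-definedness on projective classes
    (∀ x ∈ SG n t G, ∀ (v w : Fin t → ℝ) (hv0 : v ≠ 0) (hw0 : w ≠ 0),
        dotProduct v v = 1 → dotProduct w w = 1 →
        Projectivization.mk ℝ v hv0 = Projectivization.mk ℝ w hw0 →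
        ∀ L : SymSub n t →ₗ[ℝ] ℝ, Represents n t L x v ↔ Represents n t L x w) ∧
    -- every `(x,[v])` yields a pure state
    (∀ x ∈ SG n t G, ∀ v : Fin t → ℝ, dotProduct v v = 1 →
        ∃ L : SymSub n t →ₗ[ℝ] ℝ, Represents n t L x v ∧ IsPure n t G L) ∧
    -- surjectivity onto the pure states
    (∀ L : SymSub n t →ₗ[ℝ] ℝ, IsPure n t G L →
        ∃ x ∈ SG n t G, ∃ v : Fin t → ℝ, dotProduct v v = 1 ∧ Represents n t L x v) ∧
    -- injectivity
    (∀ (L L' : SymSub n t →ₗ[ℝ] ℝ), IsPure n t G L → IsPure n t G L' →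
        ∀ x ∈ SG n t G, ∀ x' ∈ SG n t G,
        ∀ (v v' : Fin t → ℝ) (hv0 : v ≠ 0) (hv0' : v' ≠ 0),
        dotProduct v v = 1 → dotProduct v' v' = 1 →
        Represents n t L x v → Represents n t L' x' v' → L = L' →
        x = x' ∧ Projectivization.mk ℝ v hv0 = Projectivization.mk ℝ v' hv0') := by
  refine ⟨fun x _ v w hv0 hw0 hv hw h L => ⟨fun hL => Represents.of_mk_eq hL hv0 hw0 hv hw h,
      fun hL => Represents.of_mk_eq hL hw0 hv0 hw hv h.symm⟩, ?_, ?_, ?_⟩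
  · exact fun x hx v hv => ⟨_, fun _ _ => rfl, isPure_evalForm hG hx hv⟩
  · exact fun L hL => hL.exists_represents hG harch
  · rintro L _ - - x - x' - v v' hv0 hv0' hv hv' hL hL' rfl
    exact Represents.unique hL hL' hv0 hv0' hv hv'
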